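/- Let p, χ, δ, d > 0 satisfy d·p ≤ 1 − 2χ/(π(δ + 1/(dδ))), define c(λ) = λ + p/λ − (2χ/π)·arctan(min(λ, 1/√d)/δ) for λ > 0, and set Λ = ( (p − δ² + (2χ/π)δ + √((p − δ² + (2χ/π)δ)² + 4δ²p))/2 )^{1/2}. Then Λ ≤ 1/√d, and for every λ > 0 one has c(λ) ≥ Λ + p/Λ − (2χ/π)·arctan(Λ/δ), with equality at λ = Λ; hence the infimum of c over λ > 0 equals Λ + p/Λ − (2χ/π)·arctan(Λ/δ). -/

import Mathlib

open Real

lemma g_deriv (p k δ y : ℝ) (hδ : 0 < δ) (hy : 0 < y) :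
    HasDerivAt (fun l => l + p / l - k * arctan (l / δ))
      (((y^2)^2 - (p - δ^2 + k * δ) * y^2 - δ^2 * p) / (y^2 * (δ^2 + y^2))) y := by
  have h1 : HasDerivAt (fun l : ℝ => l / δ) (1 / δ) y := (hasDerivAt_id y).div_const δ
  have h2 := (h1.arctan).const_mul k
  have h3 : HasDerivAt (fun l : ℝ => p / l) ((0 * y - p * 1) / y^2) y :=
    (hasDerivAt_const y p).div (hasDerivAt_id y) hy.ne'
  have h4 := ((hasDerivAt_id y).add h3).sub h2
  refine h4.congr_deriv ?_
  have : δ^2 + y^2 ≠ 0 := by positivity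
  have : 1 + (y/δ)^2 ≠ 0 := by positivity
  field_simp
  ring

lemma g_min (p k δ L l : ℝ) (hp : 0 < p) (hδ : 0 < δ) (hL : 0 < L) (hl : 0 < l)
    (hF : (L^2)^2 - (p - δ^2 + k * δ) * L^2 - δ^2 * p = 0) :
    L + p / L - k * arctan (L / δ) ≤ l + p / l - k * arctan (l / δ) := by
  have hpos : 0 < L^2 - (p - δ^2 + k * δ) := by
    have : 0 < L^2 * (L^2 - (p - δ^2 + k * δ)) := by
      have : 0 < δ^2 * p := by positivity
      nlinarith
    exact pos_of_mul_pos_right this (by positivity)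
  have key : ∀ y : ℝ, (y^2)^2 - (p - δ^2 + k * δ) * y^2 - δ^2 * p
      = (y^2 - L^2) * (y^2 + (L^2 - (p - δ^2 + k * δ))) := by
    intro y; linear_combination hF
  rcases le_total l L with h | h
  · have hanti : AntitoneOn (fun l => l + p / l - k * arctan (l / δ)) (Set.Ioc 0 L) := by
      apply antitoneOn_of_deriv_nonpos (convex_Ioc 0 L)
      · intro y hy
        exact (g_deriv p k δ y hδ hy.1).continuousAt.continuousWithinAt
      · intro y hy
        rw [interior_Ioc] at hy
        exact (g_deriv p k δ y hδ hy.1).differentiableAt.differentiableWithinAt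
      · intro y hy
        rw [interior_Ioc] at hy
        have hy0 := hy.1
        rw [(g_deriv p k δ y hδ hy.1).deriv, key]
        apply div_nonpos_of_nonpos_of_nonneg _ (by positivity)
        apply mul_nonpos_of_nonpos_of_nonneg _ (by positivity)
        nlinarith [hy.2]
    exact hanti ⟨hl, h⟩ ⟨hL, le_refl L⟩ h
  · have hmono : MonotoneOn (fun l => l + p / l - k * arctan (l / δ)) (Set.Ici L) := by
      apply monotoneOn_of_deriv_nonneg (convex_Ici L)
      · intro y hy
        exact (g_deriv p k δ y hδ (hL.trans_le hy)).continuousAt.continuousWithinAt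
      · intro y hy
        rw [interior_Ici] at hy
        exact (g_deriv p k δ y hδ (hL.trans hy)).differentiableAt.differentiableWithinAt
      · intro y hy
        rw [interior_Ici] at hy
        have hy1 : L < y := hy
        rw [(g_deriv p k δ y hδ (hL.trans hy)).deriv, key]
        apply div_nonneg _ (by positivity)
        apply mul_nonneg _ (by positivity)
        nlinarith
    exact hmono (Set.mem_Ici.2 le_rfl) h h

theorem min_speed_case_dp_small (p χ δ d : ℝ)
    (hp : 0 < p) (hχ : 0 < χ) (hδ : 0 < δ) (hd : 0 < d)
    (hdp : d * p ≤ 1 - 2 * χ / (π * (δ + 1 / (d * δ)))) :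
    let Λ : ℝ := sqrt ((p - δ ^ 2 + (2 * χ / π) * δ +
      sqrt ((p - δ ^ 2 + (2 * χ / π) * δ) ^ 2 + 4 * δ ^ 2 * p)) / 2)
    Λ ≤ 1 / sqrt d
    ∧ (∀ l > 0,
        l + p / l - (2 * χ / π) * arctan (min l (1 / sqrt d) / δ)
          ≥ Λ + p / Λ - (2 * χ / π) * arctan (Λ / δ))
    ∧ (Λ + p / Λ - (2 * χ / π) * arctan (min Λ (1 / sqrt d) / δ)
        = Λ + p / Λ - (2 * χ / π) * arctan (Λ / δ))
    ∧ IsGLB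
        ((fun l => l + p / l - (2 * χ / π) * arctan (min l (1 / sqrt d) / δ)) ''
          Set.Ioi 0)
        (Λ + p / Λ - (2 * χ / π) * arctan (Λ / δ)) := by
  intro Λ
  have hk : 0 < 2 * χ / π := by positivity
  have hdp' : d * p ≤ 1 - (2 * χ / π) * (d * δ) / (d * δ^2 + 1) := by
    have e : 2 * χ / (π * (δ + 1 / (d * δ))) = (2 * χ / π) * (d * δ) / (d * δ^2 + 1) := by
      have : d * δ^2 + 1 ≠ 0 := by positivity
      have : δ + 1 / (d * δ) ≠ 0 := by positivity
      field_simp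
    rwa [e] at hdp
  obtain ⟨k, hkd⟩ : ∃ k, k = 2 * χ / π := ⟨_, rfl⟩
  obtain ⟨A, hA⟩ : ∃ A, A = p - δ ^ 2 + (2 * χ / π) * δ := ⟨_, rfl⟩
  have hΛd : Λ = sqrt ((A + sqrt (A ^ 2 + 4 * δ ^ 2 * p)) / 2) := by rw [hA]
  clear_value Λ
  rw [← hkd] at hk hdp' hA ⊢
  have hq : 0 < 4 * δ^2 * p := by positivity
  have hS := Real.sq_sqrt (show 0 ≤ A ^ 2 + 4 * δ ^ 2 * p by positivity)
  have hSA : |A| < sqrt (A ^ 2 + 4 * δ ^ 2 * p) := by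
    rw [← Real.sqrt_sq_eq_abs]
    exact Real.sqrt_lt_sqrt (sq_nonneg A) (by linarith)
  have hX : 0 < (A + sqrt (A ^ 2 + 4 * δ ^ 2 * p)) / 2 := by
    have := neg_abs_le A
    linarith
  have hΛ : 0 < Λ := by rw [hΛd]; exact Real.sqrt_pos.2 hX
  have hΛ2 : Λ^2 = (A + sqrt (A ^ 2 + 4 * δ ^ 2 * p)) / 2 := by
    rw [hΛd]; exact Real.sq_sqrt hX.le
  have hF' : (Λ^2)^2 - A * Λ^2 - δ^2 * p = 0 := by
    rw [hΛ2]; linear_combination hS / 4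
  have hF : (Λ^2)^2 - (p - δ^2 + k * δ) * Λ^2 - δ^2 * p = 0 := by
    rw [← hA]; exact hF'
  have hle : Λ ≤ 1 / sqrt d := by
    have h1 : k * (d * δ) ≤ (1 - d * p) * (d * δ^2 + 1) := by
      rw [← div_le_iff₀ (by positivity)]; linarith
    have h2 : d * Λ^2 ≤ 1 := by
      by_contra hcon
      push Not at hcon
      have h3 : 0 < (d * Λ^2 - 1) * (d * δ^2 * p * d + d * Λ^2) := by
        apply mul_pos (by linarith) (by positivity)
      -- with x = d Λ² > 1 and F(1/d) ≥ 0
      have h5 : d * A ≤ 1 - d^2 * δ^2 * p := by rw [hA]; nlinarith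
      have h6 : d * Λ^2 * (d * A) ≤ d * Λ^2 * (1 - d^2 * δ^2 * p) :=
        mul_le_mul_of_nonneg_left h5 (by positivity)
      have h7 : (d * Λ^2)^2 = d * Λ^2 * (d * A) + d^2 * δ^2 * p := by
        linear_combination d^2 * hF'
      nlinarith
    have h3 : (Λ * sqrt d)^2 ≤ 1 := by
      rw [mul_pow, Real.sq_sqrt hd.le]; linarith
    rw [le_div_iff₀ (Real.sqrt_pos.2 hd)]
    have := Real.sqrt_nonneg d
    nlinarith
  have hmain : ∀ l > 0, l + p / l - k * arctan (min l (1 / sqrt d) / δ)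
      ≥ Λ + p / Λ - k * arctan (Λ / δ) := by
    intro l hl
    have h1 := g_min p k δ Λ l hp hδ hΛ hl hF
    have h2 : arctan (min l (1 / sqrt d) / δ) ≤ arctan (l / δ) := by
      apply Real.arctan_mono
      exact div_le_div_of_nonneg_right (min_le_left _ _) hδ.le
    have h3 := mul_le_mul_of_nonneg_left h2 hk.le
    linarith
  refine ⟨hle, hmain, by rw [min_eq_left hle], ?_, ?_⟩
  · rintro _ ⟨l, hl, rfl⟩
    exact hmain l hl
  · intro b hb
    have := hb ⟨Λ, hΛ, rfl⟩
    simpa only [min_eq_left hle] using this
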